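/- Let n = 2ν be even, J₀ the canonical antisymmetric matrix of order n, and f : ℝ^{n×n} → ℝ a Frechet differentiable function. Define V(X,Y) := f(X (Y⁻¹ + J₀) Xᵀ) for X ∈ ℝ^{n×n} and invertible Y ∈ 𝕊ₙ. Then V satisfies the partial differential equation 𝐇(M(V)) = 0 at every such (X,Y), where M(V) := (1/2) Xᵀ ∂_X V + Y ∂_Y V is formed from the partial Frobenius gradients of V and 𝐇(N) := (N + J₀ Nᵀ J₀)/2. -/

import Mathlib

open Matrix
open scoped Kronecker

attribute [local instance] Matrix.frobeniusNormedAddCommGroup Matrix.frobeniusNormedSpace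

/-- Index type for matrices of even order `n = 2ν`. -/
abbrev Idx (ν : ℕ) := Fin ν × Fin 2

/-- The canonical antisymmetric matrix `J₀ = I_ν ⊗ [[0,1],[-1,0]]` of order `n = 2ν`. -/
noncomputable def J0 (ν : ℕ) : Matrix (Idx ν) (Idx ν) ℝ :=
  (1 : Matrix (Fin ν) (Fin ν) ℝ) ⊗ₖ !![(0 : ℝ), 1; -1, 0]

/-- The subspace `𝕊ₙ` of real symmetric matrices. -/
def symMat (ν : ℕ) : Submodule ℝ (Matrix (Idx ν) (Idx ν) ℝ) where
  carrier := {Y | Yᵀ = Y}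
  add_mem' := by
    intro a b ha hb
    simp only [Set.mem_setOf_eq] at *
    rw [Matrix.transpose_add, ha, hb]
  zero_mem' := by simp
  smul_mem' := by
    intro c a ha
    simp only [Set.mem_setOf_eq] at *
    rw [Matrix.transpose_smul, ha]

/-- The Frobenius inner product `⟨A, B⟩ = tr(Aᵀ B)`. -/
noncomputable def frob {ν : ℕ} (A B : Matrix (Idx ν) (Idx ν) ℝ) : ℝ :=
  (Aᵀ * B).trace

section HamiltonianFlow

attribute [local instance] Matrix.frobeniusNormedRing Matrix.frobeniusNormedAlgebra

lemma J0_transpose (ν : ℕ) : (J0 ν)ᵀ = -J0 ν := by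
  ext ⟨i, a⟩ ⟨j, b⟩
  fin_cases a <;> fin_cases b <;> simp [J0, Matrix.one_apply, eq_comm]

lemma J0_mul_J0 (ν : ℕ) : J0 ν * J0 ν = -1 := by
  have h : (!![(0 : ℝ), 1; -1, 0] * !![(0 : ℝ), 1; -1, 0]) = (-1 : ℝ) • 1 := by
    ext i j
    fin_cases i <;> fin_cases j <;> simp
  rw [J0, ← Matrix.mul_kronecker_mul, h, Matrix.kronecker_smul, one_mul, Matrix.one_kronecker_one]
  simp

/-- The exponential of a Hamiltonian matrix is symplectic. -/
lemma exp_mul_J0_mul_exp_transpose {ν : ℕ} {A : Matrix (Idx ν) (Idx ν) ℝ}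
    (hA : A * J0 ν + J0 ν * Aᵀ = 0) :
    NormedSpace.exp A * J0 ν * NormedSpace.exp Aᵀ = J0 ν := by
  have hinv : (J0 ν)⁻¹ = -J0 ν := Matrix.inv_eq_right_inv (by rw [mul_neg, J0_mul_J0, neg_neg])
  have hu : IsUnit (J0 ν) :=
    IsUnit.of_mul_eq_one (-J0 ν) (by rw [mul_neg, J0_mul_J0, neg_neg])
  have hc : J0 ν * Aᵀ * (J0 ν)⁻¹ = -A := by
    rw [eq_neg_of_add_eq_zero_right hA, hinv, neg_mul_neg, mul_assoc, J0_mul_J0, mul_neg_one]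
  have he := Matrix.exp_conj (J0 ν) Aᵀ hu
  rw [hc, Matrix.exp_neg, hinv] at he
  have hE : NormedSpace.exp A * (NormedSpace.exp A)⁻¹ = 1 :=
    Matrix.mul_nonsing_inv _ ((Matrix.isUnit_iff_isUnit_det _).1 (Matrix.isUnit_exp A))
  have hJ : J0 ν * NormedSpace.exp Aᵀ = (NormedSpace.exp A)⁻¹ * J0 ν := by
    rw [he, mul_assoc, neg_mul, J0_mul_J0, neg_neg, mul_one]
  rw [mul_assoc, hJ, ← mul_assoc, hE, one_mul]

/-- A symplectic change of variables `(X, Y) ↦ (X S, Sᵀ Y S)` preserves `X (Y⁻¹ + J₀) Xᵀ`. -/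
lemma symplectic_invariance {ν : ℕ} {S : Matrix (Idx ν) (Idx ν) ℝ} (hS : IsUnit S)
    (hJ : S * J0 ν * Sᵀ = J0 ν) (X Y : Matrix (Idx ν) (Idx ν) ℝ) :
    X * S * ((Sᵀ * Y * S)⁻¹ + J0 ν) * (X * S)ᵀ = X * (Y⁻¹ + J0 ν) * Xᵀ := by
  have h1 : S * S⁻¹ = 1 := Matrix.mul_nonsing_inv _ ((Matrix.isUnit_iff_isUnit_det _).1 hS)
  have h2 : Sᵀ⁻¹ * Sᵀ = 1 := by
    rw [← Matrix.transpose_nonsing_inv, ← Matrix.transpose_mul, h1, Matrix.transpose_one]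
  calc X * S * ((Sᵀ * Y * S)⁻¹ + J0 ν) * (X * S)ᵀ
      = X * ((S * S⁻¹) * Y⁻¹ * (Sᵀ⁻¹ * Sᵀ) + S * J0 ν * Sᵀ) * Xᵀ := by
        rw [Matrix.mul_inv_rev, Matrix.mul_inv_rev, Matrix.transpose_mul]
        noncomm_ring
    _ = X * (Y⁻¹ + J0 ν) * Xᵀ := by rw [h1, h2, hJ, one_mul, mul_one]

/-- The orthogonal projection of a matrix onto the symmetric matrices. -/
noncomputable def symProj (ν : ℕ) : Matrix (Idx ν) (Idx ν) ℝ →L[ℝ] symMat ν :=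
  LinearMap.toContinuousLinearMap
    { toFun := fun Z => ⟨(1 / 2 : ℝ) • (Z + Zᵀ), by
        change ((1 / 2 : ℝ) • (Z + Zᵀ))ᵀ = _
        rw [Matrix.transpose_smul, Matrix.transpose_add, Matrix.transpose_transpose, add_comm]⟩
      map_add' := fun Z W => Subtype.ext (by
        change (1 / 2 : ℝ) • (Z + W + (Z + W)ᵀ) =
          (1 / 2 : ℝ) • (Z + Zᵀ) + (1 / 2 : ℝ) • (W + Wᵀ)
        rw [Matrix.transpose_add]
        module)
      map_smul' := fun c Z => Subtype.ext (by
        change (1 / 2 : ℝ) • (c • Z + (c • Z)ᵀ) = c • ((1 / 2 : ℝ) • (Z + Zᵀ))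
        rw [Matrix.transpose_smul]
        module) }

lemma coe_symProj_of_symm {ν : ℕ} {Z : Matrix (Idx ν) (Idx ν) ℝ} (hZ : Zᵀ = Z) :
    (symProj ν Z : Matrix (Idx ν) (Idx ν) ℝ) = Z := by
  change (1 / 2 : ℝ) • (Z + Zᵀ) = Z
  rw [hZ]
  module

/-- The derivative of `f (X (Y⁻¹ + J₀) Xᵀ)` vanishes along Hamiltonian directions. -/
lemma fderiv_hamiltonian_direction {ν : ℕ} (f : Matrix (Idx ν) (Idx ν) ℝ → ℝ)
    (X : Matrix (Idx ν) (Idx ν) ℝ) (Y : symMat ν)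
    (L : (Matrix (Idx ν) (Idx ν) ℝ × symMat ν) →L[ℝ] ℝ)
    (hd : HasFDerivAt
      (fun p : Matrix (Idx ν) (Idx ν) ℝ × symMat ν =>
        f (p.1 * ((p.2 : Matrix (Idx ν) (Idx ν) ℝ)⁻¹ + J0 ν) * p.1ᵀ))
      L (X, Y))
    {A : Matrix (Idx ν) (Idx ν) ℝ} (hA : A * J0 ν + J0 ν * Aᵀ = 0) :
    L (X * A, symProj ν (Aᵀ * Y + Y * A)) = 0 := by
  have hYs : (Y : Matrix (Idx ν) (Idx ν) ℝ)ᵀ = Y := Y.2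
  let S : ℝ → Matrix (Idx ν) (Idx ν) ℝ := fun t => NormedSpace.exp (t • A)
  let T : ℝ → Matrix (Idx ν) (Idx ν) ℝ := fun t => NormedSpace.exp (t • Aᵀ)
  have hT : ∀ t, T t = (S t)ᵀ := fun t => by
    simp only [S, T, ← Matrix.exp_transpose, Matrix.transpose_smul]
  have hS' : HasDerivAt S A 0 := by
    have h := hasDerivAt_exp_smul_const A (0 : ℝ)
    rw [zero_smul, NormedSpace.exp_zero, one_mul] at h
    exact h
  have hT' : HasDerivAt T Aᵀ 0 := by
    have h := hasDerivAt_exp_smul_const Aᵀ (0 : ℝ)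
    rw [zero_smul, NormedSpace.exp_zero, one_mul] at h
    exact h
  have hS0 : S 0 = 1 := by simp [S]
  have hT0 : T 0 = 1 := by simp [T]
  have h1 : HasDerivAt (fun t => X * S t) (X * A) 0 := hS'.const_mul X
  have h2 : HasDerivAt (fun t => T t * (Y : Matrix (Idx ν) (Idx ν) ℝ) * S t)
      (Aᵀ * Y + Y * A) 0 := by
    have h := (hT'.mul_const (Y : Matrix (Idx ν) (Idx ν) ℝ)).mul hS'
    rw [hS0, hT0, one_mul, mul_one] at h
    exact h
  have h3 : HasDerivAt (fun t => symProj ν (T t * (Y : Matrix (Idx ν) (Idx ν) ℝ) * S t))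
      (symProj ν (Aᵀ * Y + Y * A)) 0 := (symProj ν).hasFDerivAt.comp_hasDerivAt 0 h2
  have h4 := h1.prodMk h3
  have hpt : (X * S 0, symProj ν (T 0 * (Y : Matrix (Idx ν) (Idx ν) ℝ) * S 0)) = (X, Y) := by
    rw [hS0, hT0, one_mul, mul_one, mul_one]
    exact Prod.ext rfl (Subtype.ext (coe_symProj_of_symm hYs))
  rw [← hpt] at hd
  have h5 := hd.comp_hasDerivAt (0 : ℝ) h4
  have hconst : ((fun p : Matrix (Idx ν) (Idx ν) ℝ × symMat ν =>
        f (p.1 * ((p.2 : Matrix (Idx ν) (Idx ν) ℝ)⁻¹ + J0 ν) * p.1ᵀ)) ∘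
      fun t => (X * S t, symProj ν (T t * (Y : Matrix (Idx ν) (Idx ν) ℝ) * S t))) =
      fun _ => f (X * ((Y : Matrix (Idx ν) (Idx ν) ℝ)⁻¹ + J0 ν) * Xᵀ) := by
    funext t
    have hsym : (T t * (Y : Matrix (Idx ν) (Idx ν) ℝ) * S t)ᵀ = T t * Y * S t := by
      rw [hT, Matrix.transpose_mul, Matrix.transpose_mul, Matrix.transpose_transpose, hYs,
        mul_assoc]
    have hJ : S t * J0 ν * (S t)ᵀ = J0 ν := by
      have htA : t • A * J0 ν + J0 ν * (t • A)ᵀ = 0 := by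
        rw [Matrix.transpose_smul, smul_mul_assoc, mul_smul_comm, ← smul_add, hA, smul_zero]
      have := exp_mul_J0_mul_exp_transpose htA
      rwa [Matrix.exp_transpose] at this
    simp only [Function.comp_apply, coe_symProj_of_symm hsym]
    rw [hT, symplectic_invariance (Matrix.isUnit_exp _) hJ]
  rw [hconst] at h5
  exact h5.unique (hasDerivAt_const _ _)

end HamiltonianFlow

theorem stmt_13 (ν : ℕ)
    (f : Matrix (Idx ν) (Idx ν) ℝ → ℝ) (hf : Differentiable ℝ f)
    (X : Matrix (Idx ν) (Idx ν) ℝ) (Y : symMat ν)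
    (hY : IsUnit (Y : Matrix (Idx ν) (Idx ν) ℝ))
    -- Frobenius gradient data (∂_X V, ∂_Y V) of V(X,Y) := f(X (Y⁻¹ + J₀) Xᵀ) at (X, Y)
    (gX : Matrix (Idx ν) (Idx ν) ℝ) (gY : symMat ν)
    (L : (Matrix (Idx ν) (Idx ν) ℝ × symMat ν) →L[ℝ] ℝ)
    (hd : HasFDerivAt
      (fun p : Matrix (Idx ν) (Idx ν) ℝ × symMat ν =>
        f (p.1 * ((p.2 : Matrix (Idx ν) (Idx ν) ℝ)⁻¹ + J0 ν) * p.1ᵀ))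
      L (X, Y))
    (hrep : ∀ δ : Matrix (Idx ν) (Idx ν) ℝ × symMat ν,
      L δ = frob gX δ.1 +
        frob (gY : Matrix (Idx ν) (Idx ν) ℝ) (δ.2 : Matrix (Idx ν) (Idx ν) ℝ)) :
    -- the PDE 𝐇(M(V)) = 0 with
    -- M(V) = (1/2) Xᵀ ∂_X V + Y ∂_Y V and 𝐇(N) = (N + J₀ Nᵀ J₀)/2
    (1 / 2 : ℝ) •
      (((1 / 2 : ℝ) • (Xᵀ * gX) +
          (Y : Matrix (Idx ν) (Idx ν) ℝ) * (gY : Matrix (Idx ν) (Idx ν) ℝ)) +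
        J0 ν * ((1 / 2 : ℝ) • (Xᵀ * gX) +
          (Y : Matrix (Idx ν) (Idx ν) ℝ) * (gY : Matrix (Idx ν) (Idx ν) ℝ))ᵀ * J0 ν) = 0 := by
  set M : Matrix (Idx ν) (Idx ν) ℝ := (1 / 2 : ℝ) • (Xᵀ * gX) +
    (Y : Matrix (Idx ν) (Idx ν) ℝ) * (gY : Matrix (Idx ν) (Idx ν) ℝ) with hM
  have hYs : (Y : Matrix (Idx ν) (Idx ν) ℝ)ᵀ = Y := Y.2
  have hGs : (gY : Matrix (Idx ν) (Idx ν) ℝ)ᵀ = gY := gY.2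
  have horth : ∀ A : Matrix (Idx ν) (Idx ν) ℝ, A * J0 ν + J0 ν * Aᵀ = 0 →
      (Mᵀ * A).trace = 0 := by
    intro A hA
    have h := fderiv_hamiltonian_direction f X Y L hd hA
    rw [hrep] at h
    have hsym : (Aᵀ * (Y : Matrix (Idx ν) (Idx ν) ℝ) + (Y : Matrix (Idx ν) (Idx ν) ℝ) * A)ᵀ =
        Aᵀ * (Y : Matrix (Idx ν) (Idx ν) ℝ) + (Y : Matrix (Idx ν) (Idx ν) ℝ) * A := by
      rw [Matrix.transpose_add, Matrix.transpose_mul, Matrix.transpose_mul,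
        Matrix.transpose_transpose, hYs, add_comm]
    simp only [frob, coe_symProj_of_symm hsym, hGs] at h
    have hswap : ((gY : Matrix (Idx ν) (Idx ν) ℝ) * (Aᵀ * Y)).trace =
        ((gY : Matrix (Idx ν) (Idx ν) ℝ) * (Y * A)).trace := by
      rw [← Matrix.trace_transpose, Matrix.transpose_mul, Matrix.transpose_mul,
        Matrix.transpose_transpose, hYs, hGs, Matrix.trace_mul_comm]
    rw [mul_add, Matrix.trace_add, hswap] at h
    rw [hM, Matrix.transpose_add, Matrix.transpose_smul, Matrix.transpose_mul,
      Matrix.transpose_mul, Matrix.transpose_transpose, hYs, hGs, add_mul, smul_mul_assoc,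
      Matrix.trace_add, Matrix.trace_smul, smul_eq_mul, mul_assoc, mul_assoc]
    linarith
  set K := M + J0 ν * Mᵀ * J0 ν with hK
  have hJJ := J0_mul_J0 ν
  have hKt : Kᵀ = Mᵀ + J0 ν * M * J0 ν := by
    rw [hK, Matrix.transpose_add, Matrix.transpose_mul, Matrix.transpose_mul,
      Matrix.transpose_transpose, J0_transpose]
    noncomm_ring
  have hJK : J0 ν * Kᵀ * J0 ν = K := by
    calc J0 ν * Kᵀ * J0 ν = J0 ν * Mᵀ * J0 ν + (J0 ν * J0 ν) * M * (J0 ν * J0 ν) := by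
          rw [hKt]; noncomm_ring
      _ = K := by rw [hJJ, hK]; noncomm_ring
  have hham : K * J0 ν + J0 ν * Kᵀ = 0 := by
    nth_rewrite 1 [← hJK]
    rw [mul_assoc, hJJ]
    noncomm_ring
  have h0 := horth K hham
  have hother : ((J0 ν * M * J0 ν) * K).trace = (Mᵀ * K).trace := by
    have : J0 ν * K * J0 ν = Kᵀ := by
      calc J0 ν * K * J0 ν = (J0 ν * J0 ν) * Kᵀ * (J0 ν * J0 ν) := by
            nth_rewrite 1 [← hJK]; noncomm_ring
        _ = Kᵀ := by rw [hJJ]; noncomm_ring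
    rw [mul_assoc, mul_assoc, Matrix.trace_mul_comm, mul_assoc, mul_assoc, ← mul_assoc (J0 ν),
      this, ← Matrix.trace_transpose, Matrix.transpose_mul, Matrix.transpose_transpose,
      Matrix.trace_mul_comm]
  have hzero : (Kᵀ * K).trace = 0 := by
    nth_rewrite 1 [hKt]
    rw [add_mul, Matrix.trace_add, hother, h0, add_zero]
  have hK0 : K = 0 := by
    rw [← Matrix.conjTranspose_eq_transpose_of_trivial] at hzero
    exact Matrix.trace_conjTranspose_mul_self_eq_zero_iff.1 hzero
  rw [hK0, smul_zero]
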